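/- arXiv:1602.01159 — 3 statements merged into one kernel-verified Lean document; each statement's English description precedes it below -/
import Mathlib

section
/- Let R be a Lie conformal algebra with Z(R) = 0. Then QC(R) is closed under the λ-bracket of gc(R) (i.e. all λ-coefficients of [D₁ _λ D₂] lie in QC(R) for D₁, D₂ ∈ QC(R)) if and only if [D₁ _λ D₂] = 0 for all D₁, D₂ ∈ QC(R). In particular, if Z(R) = 0 then [D _λ E] = 0 for every D ∈ C(R) and E ∈ QC(R). -/
open scoped BigOperators

universe u

/-- The data of a Lie conformal algebra over `ℂ`: a `ℂ[∂]`-module `R` (the `ℂ`-module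
structure together with the operator `∂ = d`) and the family of coefficients of the
`λ`-bracket, so that `[a_λ b] = ∑ λ^n • coeff n a b` (a polynomial in `λ` by `locality`). -/
structure LieConformalData (R : Type u) [AddCommGroup R] [Module ℂ R] where
  d : R →ₗ[ℂ] R
  coeff : ℕ → R →ₗ[ℂ] R →ₗ[ℂ] R
  locality : ∀ a b : R, ∃ N : ℕ, ∀ n : ℕ, N ≤ n → coeff n a b = 0

/-- The `λ`-bracket evaluated at a point `lam : ℂ`.  Since `ℂ` is infinite, identities
between the (polynomial) evaluation maps are equivalent to the corresponding formal
polynomial identities in the variable `λ`. -/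
noncomputable def LieConformalData.brk {R : Type u} [AddCommGroup R] [Module ℂ R]
    (L : LieConformalData R) (lam : ℂ) (a b : R) : R :=
  ∑ᶠ n : ℕ, lam ^ n • L.coeff n a b

/-- A Lie conformal algebra over `ℂ`: conformal sesquilinearity, skew-symmetry
`[a_λ b] = -[b_{-λ-∂} a]` and the Jacobi identity
`[a_λ [b_μ c]] = [[a_λ b]_{λ+μ} c] + [b_μ [a_λ c]]`. -/
structure LieConformalAlgebra (R : Type u) [AddCommGroup R] [Module ℂ R]
    extends LieConformalData R where
  sesq_left : ∀ (lam : ℂ) (a b : R),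
    toLieConformalData.brk lam (d a) b = -(lam • toLieConformalData.brk lam a b)
  sesq_right : ∀ (lam : ℂ) (a b : R),
    toLieConformalData.brk lam a (d b)
      = d (toLieConformalData.brk lam a b) + lam • toLieConformalData.brk lam a b
  skew : ∀ (lam : ℂ) (a b : R),
    toLieConformalData.brk lam a b
      = -∑ᶠ n : ℕ, ((((-lam) • (LinearMap.id : R →ₗ[ℂ] R)) - d) ^ n) (coeff n b a)
  jacobi : ∀ (lam mu : ℂ) (a b c : R),
    toLieConformalData.brk lam a (toLieConformalData.brk mu b c)
      = (∑ᶠ n : ℕ, lam ^ n • toLieConformalData.brk (lam + mu) (coeff n a b) c)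
        + toLieConformalData.brk mu b (toLieConformalData.brk lam a c)

section

variable {R : Type u} [AddCommGroup R] [Module ℂ R]

/-- A conformal linear map from `R` to `R` (an element of the general Lie conformal
algebra `gc(R)`), given by its coefficients: `D_λ(a) = ∑ λ^n • coeff n a`, satisfying
`D_λ(∂ a) = (∂ + λ) D_λ(a)`. -/
structure CLin (L : LieConformalAlgebra R) where
  coeff : ℕ → R →ₗ[ℂ] R
  locality : ∀ a : R, ∃ N : ℕ, ∀ n : ℕ, N ≤ n → coeff n a = 0
  conf : ∀ (lam : ℂ) (a : R),
    (∑ᶠ n : ℕ, lam ^ n • coeff n (L.d a))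
      = L.d (∑ᶠ n : ℕ, lam ^ n • coeff n a) + lam • ∑ᶠ n : ℕ, lam ^ n • coeff n a

variable {L : LieConformalAlgebra R}

/-- `D.app lam a` is `D_λ(a)` evaluated at `λ = lam`. -/
noncomputable def CLin.app (D : CLin L) (lam : ℂ) (a : R) : R :=
  ∑ᶠ n : ℕ, lam ^ n • D.coeff n a

/-- Conformal derivations: `D_λ([a_μ b]) = [(D_λ a)_{λ+μ} b] + [a_μ (D_λ b)]`. -/
def IsCDer (D : CLin L) : Prop :=
  ∀ (lam mu : ℂ) (a b : R),
    D.app lam (L.brk mu a b)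
      = L.brk (lam + mu) (D.app lam a) b + L.brk mu a (D.app lam b)

/-- Conformal quasiderivations: `[(D_λ a)_{λ+μ} b] + [a_μ (D_λ b)] = D'_λ([a_μ b])`. -/
def IsQDer (D : CLin L) : Prop :=
  ∃ D' : CLin L, ∀ (lam mu : ℂ) (a b : R),
    L.brk (lam + mu) (D.app lam a) b + L.brk mu a (D.app lam b)
      = D'.app lam (L.brk mu a b)

/-- Generalized conformal derivations:
`[(D_λ a)_{λ+μ} b] + [a_μ (D'_λ b)] = D''_λ([a_μ b])`. -/
def IsGDer (D : CLin L) : Prop :=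
  ∃ D' D'' : CLin L, ∀ (lam mu : ℂ) (a b : R),
    L.brk (lam + mu) (D.app lam a) b + L.brk mu a (D'.app lam b)
      = D''.app lam (L.brk mu a b)

/-- The conformal centroid: `D_λ([a_μ b]) = [(D_λ a)_{λ+μ} b] = [a_μ (D_λ b)]`. -/
def IsCent (D : CLin L) : Prop :=
  ∀ (lam mu : ℂ) (a b : R),
    D.app lam (L.brk mu a b) = L.brk (lam + mu) (D.app lam a) b ∧
    L.brk (lam + mu) (D.app lam a) b = L.brk mu a (D.app lam b)

/-- The conformal quasicentroid: `[(D_λ a)_{λ+μ} b] = [a_μ (D_λ b)]`. -/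
def IsQC (D : CLin L) : Prop :=
  ∀ (lam mu : ℂ) (a b : R),
    L.brk (lam + mu) (D.app lam a) b = L.brk mu a (D.app lam b)

/-- `ZDer(R)`: `[(D_λ a)_μ b] = D_λ([a_μ b]) = 0`. -/
def IsZDer (D : CLin L) : Prop :=
  ∀ (lam mu : ℂ) (a b : R),
    L.brk mu (D.app lam a) b = 0 ∧ D.app lam (L.brk mu a b) = 0

/-- `F` is the family of `λ`-coefficients of the bracket `[D₁ _λ D₂]` of `gc(R)`, i.e.
`[D₁ _λ D₂]_μ (a) = D₁_λ(D₂_{μ-λ}(a)) - D₂_{μ-λ}(D₁_λ(a)) = ∑ λ^n • (F n)_μ(a)`,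
with `F` eventually zero. -/
def RepBracket (D₁ D₂ : CLin L) (F : ℕ → CLin L) : Prop :=
  (∃ N : ℕ, ∀ n : ℕ, N ≤ n → ∀ (lam : ℂ) (a : R), (F n).app lam a = 0) ∧
  ∀ (lam mu : ℂ) (a : R),
    D₁.app lam (D₂.app (mu - lam) a) - D₂.app (mu - lam) (D₁.app lam a)
      = ∑ᶠ n : ℕ, lam ^ n • (F n).app mu a

end

section

variable {R : Type u} [AddCommGroup R] [Module ℂ R]

theorem LieConformalData.support_finite (L : LieConformalData R) (lam : ℂ) (a b : R) :
    (Function.support fun n : ℕ => lam ^ n • L.coeff n a b).Finite := by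
  obtain ⟨N, hN⟩ := L.locality a b
  refine (Set.finite_lt_nat N).subset fun n hn => ?_
  by_contra h
  exact hn (by simp [hN n (not_lt.mp h)])

/-- The `λ`-bracket at a point, as a bilinear map. -/
noncomputable def LieConformalData.brkHom (L : LieConformalData R) (lam : ℂ) :
    R →ₗ[ℂ] R →ₗ[ℂ] R :=
  LinearMap.mk₂ ℂ (L.brk lam)
    (fun a a' b => by
      simp only [LieConformalData.brk, map_add, LinearMap.add_apply, smul_add]
      exact finsum_add_distrib (L.support_finite lam a b) (L.support_finite lam a' b))
    (fun c a b => by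
      simp only [LieConformalData.brk, map_smul, LinearMap.smul_apply, smul_finsum,
        smul_comm c])
    (fun a b b' => by
      simp only [LieConformalData.brk, map_add, smul_add]
      exact finsum_add_distrib (L.support_finite lam a b) (L.support_finite lam a b'))
    (fun c a b => by
      simp only [LieConformalData.brk, map_smul, smul_finsum, smul_comm c])

@[simp]
theorem LieConformalData.brkHom_apply (L : LieConformalData R) (lam : ℂ) (a b : R) :
    L.brkHom lam a b = L.brk lam a b :=
  rfl

theorem LieConformalData.brk_sub_left (L : LieConformalData R) (lam : ℂ) (a a' b : R) :
    L.brk lam (a - a') b = L.brk lam a b - L.brk lam a' b :=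
  (L.brkHom lam).map_sub₂ a a' b

theorem LieConformalData.brk_sub_right (L : LieConformalData R) (lam : ℂ) (a b b' : R) :
    L.brk lam a (b - b') = L.brk lam a b - L.brk lam a b' :=
  map_sub (L.brkHom lam a) b b'

variable {L : LieConformalAlgebra R}

/-- The zero conformal linear map. -/
instance : Zero (CLin L) where
  zero :=
    { coeff := 0
      locality := fun _ => ⟨0, fun _ _ => rfl⟩
      conf := fun _ _ => by simp }

@[simp]
theorem CLin.zero_app (lam : ℂ) (a : R) : (0 : CLin L).app lam a = 0 := by
  have h (n : ℕ) : (0 : CLin L).coeff n = 0 := rfl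
  simp [CLin.app, h]

theorem isQC_zero : IsQC (0 : CLin L) := fun lam mu a b => by
  rw [CLin.zero_app, CLin.zero_app, ← L.brkHom_apply, ← L.brkHom_apply, map_zero, map_zero,
    LinearMap.zero_apply]

/-- The operators `D₁_λ D₂_κ - D₂_κ D₁_λ` are skew for the bracket when `D₁`, `D₂` are in the
quasicentroid. -/
theorem IsQC.brk_commutator {D₁ D₂ : CLin L} (h₁ : IsQC D₁) (h₂ : IsQC D₂)
    (lam kap nu : ℂ) (a b : R) :
    L.brk (lam + kap + nu) (D₁.app lam (D₂.app kap a) - D₂.app kap (D₁.app lam a)) b =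
      -L.brk nu a (D₁.app lam (D₂.app kap b) - D₂.app kap (D₁.app lam b)) := by
  have e₁ : L.brk (lam + kap + nu) (D₁.app lam (D₂.app kap a)) b =
      L.brk nu a (D₂.app kap (D₁.app lam b)) := by
    rw [add_assoc, h₁, h₂]
  have e₂ : L.brk (lam + kap + nu) (D₂.app kap (D₁.app lam a)) b =
      L.brk nu a (D₁.app lam (D₂.app kap b)) := by
    rw [add_comm lam kap, add_assoc, h₂, h₁]
  rw [L.brk_sub_left, L.brk_sub_right, e₁, e₂, neg_sub]

/-- If the coefficients of `[D₁ _λ D₂]` lie in the quasicentroid, then so does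
`[D₁ _λ D₂]` for every value of `λ`. -/
theorem RepBracket.brk_commutator {D₁ D₂ : CLin L} {F : ℕ → CLin L}
    (hF : RepBracket D₁ D₂ F) (hQC : ∀ n, IsQC (F n)) (lam mu nu : ℂ) (a b : R) :
    L.brk (mu + nu) (D₁.app lam (D₂.app (mu - lam) a) - D₂.app (mu - lam) (D₁.app lam a)) b =
      L.brk nu a (D₁.app lam (D₂.app (mu - lam) b) - D₂.app (mu - lam) (D₁.app lam b)) := by
  obtain ⟨⟨N, hN⟩, hF⟩ := hF
  have hsum (c : R) : ∑ᶠ n : ℕ, lam ^ n • (F n).app mu c =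
      ∑ n ∈ Finset.range N, lam ^ n • (F n).app mu c := by
    refine finsum_eq_sum_of_support_subset _ fun n hn => ?_
    by_contra h
    exact hn (by simp [hN n (by simpa using h)])
  rw [hF, hF, hsum, hsum, ← L.brkHom_apply, ← L.brkHom_apply nu]
  simp only [map_sum, LinearMap.sum_apply, map_smul, LinearMap.smul_apply]
  exact Finset.sum_congr rfl fun n _ => by
    rw [L.brkHom_apply, L.brkHom_apply, hQC n]

end

/-- Let `Z(R) = 0`. Then `QC(R)` is closed under the `λ`-bracket of
`gc(R)` (all `λ`-coefficients of `[D₁ _λ D₂]` lie in `QC(R)` for `D₁, D₂ ∈ QC(R)`) if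
and only if `[D₁ _λ D₂] = 0` for all `D₁, D₂ ∈ QC(R)`.  In particular `[D _λ E] = 0`
for every `D ∈ C(R)` and `E ∈ QC(R)`. -/
theorem stmt13 {R : Type u} [AddCommGroup R] [Module ℂ R] (L : LieConformalAlgebra R)
    (hZ : ∀ a : R, (∀ (lam : ℂ) (b : R), L.brk lam a b = 0) → a = 0) :
    ((∀ D₁ D₂ : CLin L, IsQC D₁ → IsQC D₂ →
        ∃ F : ℕ → CLin L, RepBracket D₁ D₂ F ∧ ∀ n : ℕ, IsQC (F n)) ↔
      (∀ D₁ D₂ : CLin L, IsQC D₁ → IsQC D₂ → ∀ (lam mu : ℂ) (a : R),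
        D₁.app lam (D₂.app (mu - lam) a) - D₂.app (mu - lam) (D₁.app lam a) = 0)) ∧
    (∀ D E : CLin L, IsCent D → IsQC E → ∀ (lam mu : ℂ) (a : R),
      D.app lam (E.app (mu - lam) a) - E.app (mu - lam) (D.app lam a) = 0) := by
  refine ⟨⟨fun h D₁ D₂ h₁ h₂ lam mu a => ?_, fun h D₁ D₂ h₁ h₂ => ?_⟩,
    fun D E hD hE lam mu a => ?_⟩
  · obtain ⟨F, hF, hQC⟩ := h D₁ D₂ h₁ h₂
    refine hZ _ fun nu b => ?_
    have skew := h₁.brk_commutator h₂ lam (mu - lam) (nu - mu) a b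
    have symm := hF.brk_commutator hQC lam mu (nu - mu) a b
    rw [add_sub_cancel] at skew
    rw [← symm] at skew
    rw [add_sub_cancel] at skew
    have : Module ℚ R := Module.compHom R (algebraMap ℚ ℂ)
    have : IsAddTorsionFree R := .of_module_rat R
    exact self_eq_neg.mp skew
  · exact ⟨0, ⟨⟨0, fun n _ lam a => CLin.zero_app lam a⟩, fun lam mu a => by
      simp [h D₁ D₂ h₁ h₂ lam mu a]⟩, fun _ => isQC_zero⟩
  · refine hZ _ fun nu b => ?_
    have e₁ : L.brk nu (D.app lam (E.app (mu - lam) a)) b =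
        D.app lam (L.brk (nu - lam) (E.app (mu - lam) a) b) := by
      rw [(hD _ _ _ _).1, add_sub_cancel]
    have e₂ : L.brk (nu - lam) (E.app (mu - lam) a) b =
        L.brk (nu - mu) a (E.app (mu - lam) b) := by
      rw [← hE]
      congr 1
      ring
    have e₃ : L.brk nu (E.app (mu - lam) (D.app lam a)) b =
        L.brk (lam + (nu - mu)) (D.app lam a) (E.app (mu - lam) b) := by
      rw [← hE]
      congr 1
      ring
    rw [L.brk_sub_left, e₁, e₂, e₃, (hD _ _ _ _).1, sub_self]
end

section
/- Let R be a Lie conformal algebra with Z(R) = 0 and suppose R = S ⊕ T, where S and T are ideals of R. Then every D ∈ GDer(R) satisfies D_λ(S) ⊆ S[λ] and D_λ(T) ⊆ T[λ], and restriction gives identifications GDer(R) = GDer(S) ⊕ GDer(T), QDer(R) = QDer(S) ⊕ QDer(T), C(R) = C(S) ⊕ C(T), and QC(R) = QC(S) ⊕ QC(T). -/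
open scoped BigOperators

universe u

section Stmt15

variable {R : Type u} [AddCommGroup R] [Module ℂ R]

/-- `DS` is the restriction of `D` to the (invariant) submodule `S`, where `S` carries
the induced Lie conformal algebra structure `LS`. -/
def IsRestriction (L : LieConformalAlgebra R) (S : Submodule ℂ R)
    (LS : LieConformalAlgebra ↥S) (D : CLin L) (DS : CLin LS) : Prop :=
  ∀ (lam : ℂ) (a : ↥S), (DS.app lam a : R) = D.app lam (a : R)

end Stmt15

section PolynomialEvaluation

variable {M N : Type*} [AddCommGroup M] [Module ℂ M] [AddCommGroup N] [Module ℂ N]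

theorem hasFiniteSupport_pow_smul {c : ℕ → M} (hc : ∃ N : ℕ, ∀ n : ℕ, N ≤ n → c n = 0) (z : ℂ) :
    Function.HasFiniteSupport fun n => z ^ n • c n := by
  obtain ⟨N, hN⟩ := hc
  refine (Set.finite_lt_nat N).subset fun n hn => ?_
  by_contra hlt
  exact hn (by simp [hN n (not_lt.mp hlt)])

theorem LinearMap.map_finsum_pow_smul (f : M →ₗ[ℂ] N) {c : ℕ → M}
    (hc : ∃ N : ℕ, ∀ n : ℕ, N ≤ n → c n = 0) (z : ℂ) :
    f (∑ᶠ n : ℕ, z ^ n • c n) = ∑ᶠ n : ℕ, z ^ n • f (c n) := by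
  simp [map_finsum f (hasFiniteSupport_pow_smul hc z)]

theorem finsum_pow_smul_add {c c' : ℕ → M} (hc : ∃ N : ℕ, ∀ n : ℕ, N ≤ n → c n = 0)
    (hc' : ∃ N : ℕ, ∀ n : ℕ, N ≤ n → c' n = 0) (z : ℂ) :
    ∑ᶠ n : ℕ, z ^ n • (c n + c' n) = ∑ᶠ n : ℕ, z ^ n • c n + ∑ᶠ n : ℕ, z ^ n • c' n := by
  simp only [smul_add]
  exact finsum_add_distrib (hasFiniteSupport_pow_smul hc z) (hasFiniteSupport_pow_smul hc' z)

/-- A vector-valued polynomial that vanishes at every point of `ℂ` has zero coefficients. -/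
theorem eq_zero_of_finsum_pow_smul_eq_zero {c : ℕ → M} (hc : ∃ N : ℕ, ∀ n : ℕ, N ≤ n → c n = 0)
    (h : ∀ z : ℂ, ∑ᶠ n : ℕ, z ^ n • c n = 0) (n : ℕ) : c n = 0 := by
  rw [← Module.forall_dual_apply_eq_zero_iff ℂ]
  intro φ
  obtain ⟨N, hN⟩ := id hc
  let p : Polynomial ℂ := ∑ i ∈ Finset.range N, Polynomial.monomial i (φ (c i))
  have hp : p = 0 := by
    refine Polynomial.funext fun z => ?_
    have hz := φ.map_finsum_pow_smul hc z
    rw [h z, map_zero, finsum_eq_sum_of_support_subset (s := Finset.range N)] at hz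
    · simpa [p, Polynomial.eval_finsetSum, mul_comm] using hz.symm
    · intro i hi
      by_contra hlt
      exact hi (by simp [hN i (by simpa using hlt)])
  rcases lt_or_ge n N with hn | hn
  · have := congrArg (fun q => Polynomial.coeff q n) hp
    simpa [p, Polynomial.finsetSum_coeff, Polynomial.coeff_monomial, hn] using this
  · simp [hN n hn]

end PolynomialEvaluation

section Linearity

variable {R : Type u} [AddCommGroup R] [Module ℂ R]

theorem LieConformalData.brk_add_left (L : LieConformalData R) (z : ℂ) (a a' b : R) :
    L.brk z (a + a') b = L.brk z a b + L.brk z a' b := by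
  simp only [LieConformalData.brk, map_add, LinearMap.add_apply]
  exact finsum_pow_smul_add (L.locality a b) (L.locality a' b) z

theorem LieConformalData.brk_add_right (L : LieConformalData R) (z : ℂ) (a b b' : R) :
    L.brk z a (b + b') = L.brk z a b + L.brk z a b' := by
  simp only [LieConformalData.brk, map_add]
  exact finsum_pow_smul_add (L.locality a b) (L.locality a b') z

theorem LieConformalData.brk_zero_left (L : LieConformalData R) (z : ℂ) (b : R) :
    L.brk z 0 b = 0 := by
  simp [LieConformalData.brk]

theorem Submodule.finsum_mem_of_forall {M : Type*} [AddCommGroup M] [Module ℂ M]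
    (S : Submodule ℂ M) {f : ℕ → M} (hf : ∀ n, f n ∈ S) : ∑ᶠ n, f n ∈ S :=
  finsum_induction (· ∈ S) S.zero_mem (fun _ _ => S.add_mem) hf

variable {L : LieConformalAlgebra R}

theorem CLin.app_add (D : CLin L) (z : ℂ) (a b : R) :
    D.app z (a + b) = D.app z a + D.app z b := by
  simp only [CLin.app, map_add]
  exact finsum_pow_smul_add (D.locality a) (D.locality b) z

theorem CLin.app_zero (D : CLin L) (z : ℂ) : D.app z 0 = 0 := by
  simp [CLin.app]

theorem CLin.app_d (D : CLin L) (z : ℂ) (a : R) :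
    D.app z (L.d a) = L.d (D.app z a) + z • D.app z a :=
  D.conf z a

theorem CLin.coeff_mem_of_app_mem (D : CLin L) (S : Submodule ℂ R) {a : R}
    (h : ∀ z, D.app z a ∈ S) (n : ℕ) : D.coeff n a ∈ S := by
  obtain ⟨N, hN⟩ := id (D.locality a)
  rw [← Submodule.Quotient.mk_eq_zero]
  refine eq_zero_of_finsum_pow_smul_eq_zero (c := fun n => S.mkQ (D.coeff n a))
    ⟨N, fun n hn => by simp [hN n hn]⟩ (fun z => ?_) n
  rw [← S.mkQ.map_finsum_pow_smul (D.locality a)]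
  exact (Submodule.Quotient.mk_eq_zero S).mpr (h z)

end Linearity

section IdealDecomposition

variable {R : Type u} [AddCommGroup R] [Module ℂ R]

/-- `L` is the direct sum of its ideals `S` and `T`, and `LS`, `LT` are the induced
Lie conformal algebra structures. -/
structure IsIdealDecomposition (L : LieConformalAlgebra R) (S T : Submodule ℂ R)
    (LS : LieConformalAlgebra ↥S) (LT : LieConformalAlgebra ↥T) : Prop where
  d_mem_left : ∀ a ∈ S, L.d a ∈ S
  coeff_mem_left : ∀ (a : R), ∀ b ∈ S, ∀ n : ℕ, L.coeff n a b ∈ S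
  d_mem_right : ∀ a ∈ T, L.d a ∈ T
  coeff_mem_right : ∀ (a : R), ∀ b ∈ T, ∀ n : ℕ, L.coeff n a b ∈ T
  isCompl : IsCompl S T
  coe_d_left : ∀ a : ↥S, (LS.d a : R) = L.d (a : R)
  coe_coeff_left : ∀ (n : ℕ) (a b : ↥S),
    ((LS.coeff n a b : ↥S) : R) = L.coeff n (a : R) (b : R)
  coe_d_right : ∀ a : ↥T, (LT.d a : R) = L.d (a : R)
  coe_coeff_right : ∀ (n : ℕ) (a b : ↥T),
    ((LT.coeff n a b : ↥T) : R) = L.coeff n (a : R) (b : R)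

namespace IsIdealDecomposition

variable {L : LieConformalAlgebra R} {S T : Submodule ℂ R}
  {LS : LieConformalAlgebra ↥S} {LT : LieConformalAlgebra ↥T}

theorem symm (h : IsIdealDecomposition L S T LS LT) : IsIdealDecomposition L T S LT LS where
  d_mem_left := h.d_mem_right
  coeff_mem_left := h.coeff_mem_right
  d_mem_right := h.d_mem_left
  coeff_mem_right := h.coeff_mem_left
  isCompl := h.isCompl.symm
  coe_d_left := h.coe_d_right
  coe_coeff_left := h.coe_coeff_right
  coe_d_right := h.coe_d_left
  coe_coeff_right := h.coe_coeff_left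

/-- The projection of `R` onto the summand `S`. -/
noncomputable def proj (h : IsIdealDecomposition L S T LS LT) : R →ₗ[ℂ] S :=
  S.projectionOnto T h.isCompl

theorem proj_coe (h : IsIdealDecomposition L S T LS LT) (a : S) : h.proj a = a :=
  Submodule.projectionOnto_apply_left h.isCompl a

theorem proj_eq_zero_iff (h : IsIdealDecomposition L S T LS LT) {a : R} :
    h.proj a = 0 ↔ a ∈ T :=
  Submodule.projectionOnto_apply_eq_zero_iff h.isCompl

theorem symm_proj_coe (h : IsIdealDecomposition L S T LS LT) (a : S) :
    h.symm.proj (a : R) = 0 :=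
  h.symm.proj_eq_zero_iff.mpr a.2

theorem coe_proj_of_mem (h : IsIdealDecomposition L S T LS LT) {a : R} (ha : a ∈ S) :
    (h.proj a : R) = a :=
  congrArg Subtype.val (h.proj_coe ⟨a, ha⟩)

theorem proj_add_proj (h : IsIdealDecomposition L S T LS LT) (a : R) :
    (h.proj a : R) + h.symm.proj a = a := by
  have ha : a ∈ S ⊔ T := h.isCompl.sup_eq_top ▸ Submodule.mem_top
  obtain ⟨s, hs, t, ht, rfl⟩ := Submodule.mem_sup.mp ha
  simp [h.coe_proj_of_mem hs, h.symm.coe_proj_of_mem ht, h.proj_eq_zero_iff.mpr ht,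
    h.symm.proj_eq_zero_iff.mpr hs]

theorem ext_proj (h : IsIdealDecomposition L S T LS LT) {a b : R}
    (hS : h.proj a = h.proj b) (hT : h.symm.proj a = h.symm.proj b) : a = b := by
  rw [← h.proj_add_proj a, ← h.proj_add_proj b, hS, hT]

theorem mem_left_iff (h : IsIdealDecomposition L S T LS LT) {a : R} :
    a ∈ S ↔ h.symm.proj a = 0 :=
  h.symm.proj_eq_zero_iff.symm

theorem proj_d (h : IsIdealDecomposition L S T LS LT) (a : R) :
    h.proj (L.d a) = LS.d (h.proj a) := by
  conv_lhs => rw [← h.proj_add_proj a]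
  rw [map_add, map_add, ← h.coe_d_left, h.proj_coe,
    h.proj_eq_zero_iff.mpr (h.d_mem_right _ (h.symm.proj a).2), add_zero]

theorem brk_mem_right_of_right (h : IsIdealDecomposition L S T LS LT) (z : ℂ) (a : R) {b : R}
    (hb : b ∈ T) : L.brk z a b ∈ T :=
  T.finsum_mem_of_forall fun n => T.smul_mem _ (h.coeff_mem_right a b hb n)

theorem brk_mem_right_of_left (h : IsIdealDecomposition L S T LS LT) (z : ℂ) {a : R} (b : R)
    (ha : a ∈ T) : L.brk z a b ∈ T := by
  rw [L.skew]
  refine T.neg_mem (T.finsum_mem_of_forall fun n => ?_)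
  refine Module.End.pow_apply_mem_of_forall_mem n (fun x hx => ?_) _ (h.coeff_mem_right b a ha n)
  exact T.sub_mem (T.smul_mem _ hx) (h.d_mem_right x hx)

theorem coe_brk (h : IsIdealDecomposition L S T LS LT) (z : ℂ) (a b : S) :
    (LS.brk z a b : R) = L.brk z a b := by
  simp only [LieConformalData.brk, ← h.coe_coeff_left]
  exact S.subtype.map_finsum_pow_smul (LS.locality a b) z

/-- The projection onto an ideal summand is a homomorphism of Lie conformal algebras. -/
theorem proj_brk (h : IsIdealDecomposition L S T LS LT) (z : ℂ) (a b : R) :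
    h.proj (L.brk z a b) = LS.brk z (h.proj a) (h.proj b) := by
  conv_lhs => rw [← h.proj_add_proj a, L.brk_add_left, map_add,
    h.proj_eq_zero_iff.mpr (h.brk_mem_right_of_left z b (h.symm.proj a).2), add_zero,
    ← h.proj_add_proj b, L.brk_add_right, map_add,
    h.proj_eq_zero_iff.mpr (h.brk_mem_right_of_right z _ (h.symm.proj b).2), add_zero,
    ← h.coe_brk, h.proj_coe]

/-- The compression of a conformal linear map to the summand `S`. -/
noncomputable def compress (h : IsIdealDecomposition L S T LS LT) (D : CLin L) : CLin LS where
  coeff n := h.proj ∘ₗ D.coeff n ∘ₗ S.subtype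
  locality a := by
    obtain ⟨N, hN⟩ := D.locality a
    exact ⟨N, fun n hn => by simp [hN n hn]⟩
  conf z a := by
    simp only [LinearMap.comp_apply, Submodule.subtype_apply, h.coe_d_left]
    rw [← h.proj.map_finsum_pow_smul (D.locality _), ← h.proj.map_finsum_pow_smul (D.locality _),
      D.conf, map_add, map_smul, h.proj_d]

theorem compress_app (h : IsIdealDecomposition L S T LS LT) (D : CLin L) (z : ℂ) (a : S) :
    (h.compress D).app z a = h.proj (D.app z a) :=
  (h.proj.map_finsum_pow_smul (D.locality _) z).symm

/-- The coefficients of a conformal linear map on the summand `S`, extended by zero on `T`. -/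
noncomputable def extendCoeff (h : IsIdealDecomposition L S T LS LT) (D : CLin LS) (n : ℕ) :
    R →ₗ[ℂ] R :=
  S.subtype ∘ₗ D.coeff n ∘ₗ h.proj

theorem extendCoeff_locality (h : IsIdealDecomposition L S T LS LT) (D : CLin LS) (a : R) :
    ∃ N : ℕ, ∀ n : ℕ, N ≤ n → h.extendCoeff D n a = 0 := by
  obtain ⟨N, hN⟩ := D.locality (h.proj a)
  exact ⟨N, fun n hn => by simp [extendCoeff, hN n hn]⟩

theorem finsum_extendCoeff (h : IsIdealDecomposition L S T LS LT) (D : CLin LS) (z : ℂ) (a : R) :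
    ∑ᶠ n : ℕ, z ^ n • h.extendCoeff D n a = D.app z (h.proj a) :=
  (S.subtype.map_finsum_pow_smul (D.locality _) z).symm

theorem finsum_sumCoeff (h : IsIdealDecomposition L S T LS LT) (DS : CLin LS) (DT : CLin LT)
    (z : ℂ) (a : R) :
    ∑ᶠ n : ℕ, z ^ n • (h.extendCoeff DS n + h.symm.extendCoeff DT n) a =
      DS.app z (h.proj a) + DT.app z (h.symm.proj a) := by
  simp only [LinearMap.add_apply]
  rw [finsum_pow_smul_add (h.extendCoeff_locality DS a) (h.symm.extendCoeff_locality DT a),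
    finsum_extendCoeff, finsum_extendCoeff]

/-- The direct sum of conformal linear maps on the two summands. -/
noncomputable def sum (h : IsIdealDecomposition L S T LS LT) (DS : CLin LS) (DT : CLin LT) :
    CLin L where
  coeff n := h.extendCoeff DS n + h.symm.extendCoeff DT n
  locality a := by
    obtain ⟨N, hN⟩ := h.extendCoeff_locality DS a
    obtain ⟨N', hN'⟩ := h.symm.extendCoeff_locality DT a
    exact ⟨max N N', fun n hn => by
      simp [hN n (le_of_max_le_left hn), hN' n (le_of_max_le_right hn)]⟩
  conf z a := by
    simp only [h.finsum_sumCoeff, h.proj_d, h.symm.proj_d, CLin.app_d, Submodule.coe_add,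
      Submodule.coe_smul, h.coe_d_left, h.coe_d_right, map_add, smul_add]
    abel

theorem sum_app (h : IsIdealDecomposition L S T LS LT) (DS : CLin LS) (DT : CLin LT) (z : ℂ)
    (a : R) :
    (h.sum DS DT).app z a = DS.app z (h.proj a) + DT.app z (h.symm.proj a) :=
  h.finsum_sumCoeff DS DT z a

theorem isRestriction_sum_left (h : IsIdealDecomposition L S T LS LT) (DS : CLin LS)
    (DT : CLin LT) : IsRestriction L S LS (h.sum DS DT) DS := fun z a => by
  simp [h.sum_app, h.proj_coe, h.symm_proj_coe, CLin.app_zero]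

theorem isRestriction_sum_right (h : IsIdealDecomposition L S T LS LT) (DS : CLin LS)
    (DT : CLin LT) : IsRestriction L T LT (h.sum DS DT) DT := fun z a => by
  simp [h.sum_app, h.symm.proj_coe, h.symm.symm_proj_coe, CLin.app_zero]

theorem proj_app (h : IsIdealDecomposition L S T LS LT) {D : CLin L} {DS : CLin LS}
    {DT : CLin LT} (hS : IsRestriction L S LS D DS) (hT : IsRestriction L T LT D DT) (z : ℂ)
    (a : R) : h.proj (D.app z a) = DS.app z (h.proj a) := by
  conv_lhs => rw [← h.proj_add_proj a, D.app_add, ← hS, ← hT, map_add, h.proj_coe,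
    h.symm.symm_proj_coe, add_zero]

/-- If `Z(R) = 0` and `[(D_λ a)_ν b] ∈ S[λ, ν]` for all `a ∈ S` and `b ∈ T`, then `D`
preserves `S`. -/
theorem app_mem (h : IsIdealDecomposition L S T LS LT)
    (hZ : ∀ a : R, (∀ (z : ℂ) (b : R), L.brk z a b = 0) → a = 0) {D : CLin L}
    (hD : ∀ (lam mu : ℂ), ∀ a ∈ S, ∀ b ∈ T, L.brk (lam + mu) (D.app lam a) b ∈ S)
    (lam : ℂ) {a : R} (ha : a ∈ S) : D.app lam a ∈ S := by
  rw [h.mem_left_iff, ← Submodule.coe_eq_zero]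
  refine hZ _ fun z b => h.ext_proj ?_ ?_
  · rw [h.proj_brk, h.symm.symm_proj_coe, LieConformalData.brk_zero_left, map_zero]
  · have hb := hD lam (z - lam) a ha _ (h.symm.proj b).2
    rw [h.mem_left_iff, add_sub_cancel, h.symm.proj_brk, h.symm.proj_coe] at hb
    rw [h.symm.proj_brk, h.symm.proj_coe, hb, map_zero]

theorem isRestriction_compress (h : IsIdealDecomposition L S T LS LT) {D : CLin L}
    (hD : ∀ (z : ℂ), ∀ a ∈ S, D.app z a ∈ S) : IsRestriction L S LS D (h.compress D) :=
  fun z a => by rw [h.compress_app, h.coe_proj_of_mem (hD z a a.2)]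

theorem brk_eq_zero (h : IsIdealDecomposition L S T LS LT) (z : ℂ) {a b : R} (ha : a ∈ S)
    (hb : b ∈ T) : L.brk z a b = 0 :=
  Submodule.disjoint_def.mp h.isCompl.disjoint _ (h.symm.brk_mem_right_of_left z b ha)
    (h.brk_mem_right_of_right z a hb)

theorem app_mem_of_isGDer (h : IsIdealDecomposition L S T LS LT)
    (hZ : ∀ a : R, (∀ (z : ℂ) (b : R), L.brk z a b = 0) → a = 0) {D : CLin L} (hD : IsGDer D)
    (z : ℂ) : ∀ a ∈ S, D.app z a ∈ S := by
  obtain ⟨D', D'', hD⟩ := hD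
  refine fun a ha => h.app_mem hZ (fun lam mu a ha b hb => ?_) z ha
  rw [eq_sub_of_add_eq (hD lam mu a b), h.brk_eq_zero mu ha hb, D''.app_zero, zero_sub]
  exact S.neg_mem (h.symm.brk_mem_right_of_left mu _ ha)

theorem app_mem_of_isQC (h : IsIdealDecomposition L S T LS LT)
    (hZ : ∀ a : R, (∀ (z : ℂ) (b : R), L.brk z a b = 0) → a = 0) {D : CLin L} (hD : IsQC D)
    (z : ℂ) : ∀ a ∈ S, D.app z a ∈ S := by
  refine fun a ha => h.app_mem hZ (fun lam mu a ha b hb => ?_) z ha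
  rw [hD lam mu a b]
  exact h.symm.brk_mem_right_of_left mu _ ha

theorem isGDer_restriction (h : IsIdealDecomposition L S T LS LT) {D : CLin L} {DS : CLin LS}
    (hS : IsRestriction L S LS D DS) (hD : IsGDer D) : IsGDer DS := by
  obtain ⟨D', D'', hD⟩ := hD
  refine ⟨h.compress D', h.compress D'', fun lam mu a b => ?_⟩
  have := congrArg h.proj (hD lam mu a b)
  rwa [map_add, h.proj_brk, h.proj_brk, ← hS, h.proj_coe, h.proj_coe, h.proj_coe,
    ← h.coe_brk, ← h.compress_app, ← h.compress_app] at this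

theorem isQDer_restriction (h : IsIdealDecomposition L S T LS LT) {D : CLin L} {DS : CLin LS}
    (hS : IsRestriction L S LS D DS) (hD : IsQDer D) : IsQDer DS := by
  obtain ⟨D', hD⟩ := hD
  refine ⟨h.compress D', fun lam mu a b => Subtype.ext ?_⟩
  rw [h.compress_app, h.coe_brk, ← hD, ← hS, ← hS, ← h.coe_brk, ← h.coe_brk,
    ← Submodule.coe_add, h.proj_coe]

theorem isCent_restriction (h : IsIdealDecomposition L S T LS LT) {D : CLin L} {DS : CLin LS}
    (hS : IsRestriction L S LS D DS) (hD : IsCent D) : IsCent DS := fun lam mu a b =>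
  ⟨Subtype.ext (by rw [hS, h.coe_brk, h.coe_brk, hS, (hD lam mu a b).1]),
    Subtype.ext (by rw [h.coe_brk, h.coe_brk, hS, hS, (hD lam mu a b).2])⟩

theorem isQC_restriction (h : IsIdealDecomposition L S T LS LT) {D : CLin L} {DS : CLin LS}
    (hS : IsRestriction L S LS D DS) (hD : IsQC D) : IsQC DS := fun lam mu a b =>
  Subtype.ext (by rw [h.coe_brk, h.coe_brk, hS, hS, hD lam mu a b])

section Assemble

variable {D : CLin L} {DS : CLin LS} {DT : CLin LT}

theorem isGDer_of_restrictions (h : IsIdealDecomposition L S T LS LT)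
    (hS : IsRestriction L S LS D DS) (hT : IsRestriction L T LT D DT) (hDS : IsGDer DS)
    (hDT : IsGDer DT) : IsGDer D := by
  obtain ⟨DS', DS'', hDS⟩ := hDS
  obtain ⟨DT', DT'', hDT⟩ := hDT
  have hS' := h.isRestriction_sum_left DS' DT'
  have hT' := h.isRestriction_sum_right DS' DT'
  have hS'' := h.isRestriction_sum_left DS'' DT''
  have hT'' := h.isRestriction_sum_right DS'' DT''
  refine ⟨h.sum DS' DT', h.sum DS'' DT'', fun lam mu a b => h.ext_proj ?_ ?_⟩
  · simp only [map_add, h.proj_brk, h.proj_app hS hT, h.proj_app hS' hT', h.proj_app hS'' hT'',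
      hDS]
  · simp only [map_add, h.symm.proj_brk, h.symm.proj_app hT hS, h.symm.proj_app hT' hS',
      h.symm.proj_app hT'' hS'', hDT]

theorem isQDer_of_restrictions (h : IsIdealDecomposition L S T LS LT)
    (hS : IsRestriction L S LS D DS) (hT : IsRestriction L T LT D DT) (hDS : IsQDer DS)
    (hDT : IsQDer DT) : IsQDer D := by
  obtain ⟨DS', hDS⟩ := hDS
  obtain ⟨DT', hDT⟩ := hDT
  have hS' := h.isRestriction_sum_left DS' DT'
  have hT' := h.isRestriction_sum_right DS' DT'
  refine ⟨h.sum DS' DT', fun lam mu a b => h.ext_proj ?_ ?_⟩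
  · simp only [map_add, h.proj_brk, h.proj_app hS hT, h.proj_app hS' hT', hDS]
  · simp only [map_add, h.symm.proj_brk, h.symm.proj_app hT hS, h.symm.proj_app hT' hS', hDT]

theorem isQC_of_restrictions (h : IsIdealDecomposition L S T LS LT)
    (hS : IsRestriction L S LS D DS) (hT : IsRestriction L T LT D DT) (hDS : IsQC DS)
    (hDT : IsQC DT) : IsQC D := fun lam mu a b => h.ext_proj
  (by simp only [h.proj_brk, h.proj_app hS hT, hDS lam mu])
  (by simp only [h.symm.proj_brk, h.symm.proj_app hT hS, hDT lam mu])

theorem isCent_of_restrictions (h : IsIdealDecomposition L S T LS LT)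
    (hS : IsRestriction L S LS D DS) (hT : IsRestriction L T LT D DT) (hDS : IsCent DS)
    (hDT : IsCent DT) : IsCent D := fun lam mu a b =>
  ⟨h.ext_proj (by simp only [h.proj_brk, h.proj_app hS hT, (hDS lam mu _ _).1])
      (by simp only [h.symm.proj_brk, h.symm.proj_app hT hS, (hDT lam mu _ _).1]),
    h.isQC_of_restrictions hS hT (fun lam mu a b => (hDS lam mu a b).2)
      (fun lam mu a b => (hDT lam mu a b).2) lam mu a b⟩

end Assemble

theorem exists_restrictions (h : IsIdealDecomposition L S T LS LT) {D : CLin L}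
    (hS : ∀ (z : ℂ), ∀ a ∈ S, D.app z a ∈ S) (hT : ∀ (z : ℂ), ∀ a ∈ T, D.app z a ∈ T) :
    ∃ (DS : CLin LS) (DT : CLin LT), IsRestriction L S LS D DS ∧ IsRestriction L T LT D DT :=
  ⟨h.compress D, h.symm.compress D, h.isRestriction_compress hS, h.symm.isRestriction_compress hT⟩

theorem exists_of_restrictions (h : IsIdealDecomposition L S T LS LT) (DS : CLin LS)
    (DT : CLin LT) : ∃ D : CLin L, IsRestriction L S LS D DS ∧ IsRestriction L T LT D DT :=
  ⟨h.sum DS DT, h.isRestriction_sum_left DS DT, h.isRestriction_sum_right DS DT⟩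

end IsIdealDecomposition

end IdealDecomposition

theorem IsQDer.isGDer {R : Type u} [AddCommGroup R] [Module ℂ R] {L : LieConformalAlgebra R}
    {D : CLin L} (hD : IsQDer D) : IsGDer D :=
  ⟨D, hD⟩

theorem IsCent.isQC {R : Type u} [AddCommGroup R] [Module ℂ R] {L : LieConformalAlgebra R}
    {D : CLin L} (hD : IsCent D) : IsQC D :=
  fun lam mu a b => (hD lam mu a b).2

/-- Let `R` be a Lie conformal algebra with `Z(R) = 0`, and
`R = S ⊕ T` with `S`, `T` ideals of `R` (here `LS`, `LT` are the induced Lie conformal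
algebra structures on `S` and `T`).  Then every `D ∈ GDer(R)` preserves `S` and `T`
(`D_λ(S) ⊆ S[λ]`, `D_λ(T) ⊆ T[λ]`), restriction is injective on `gc(R)`-elements
preserving the pieces, and for each of `GDer`, `QDer`, `C`, `QC`: membership of `D` is
equivalent to membership of both restrictions, restrictions exist, and every pair of
members on `S` and `T` arises by restriction — i.e. `GDer(R) = GDer(S) ⊕ GDer(T)`,
`QDer(R) = QDer(S) ⊕ QDer(T)`, `C(R) = C(S) ⊕ C(T)`, `QC(R) = QC(S) ⊕ QC(T)`. -/
theorem stmt15 {R : Type u} [AddCommGroup R] [Module ℂ R] (L : LieConformalAlgebra R)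
    (hZ : ∀ a : R, (∀ (lam : ℂ) (b : R), L.brk lam a b = 0) → a = 0)
    (S T : Submodule ℂ R)
    (hSd : ∀ a ∈ S, L.d a ∈ S) (hSb : ∀ (a : R), ∀ b ∈ S, ∀ n : ℕ, L.coeff n a b ∈ S)
    (hTd : ∀ a ∈ T, L.d a ∈ T) (hTb : ∀ (a : R), ∀ b ∈ T, ∀ n : ℕ, L.coeff n a b ∈ T)
    (hcompl : IsCompl S T)
    (LS : LieConformalAlgebra ↥S)
    (hLSd : ∀ a : ↥S, (LS.d a : R) = L.d (a : R))
    (hLSc : ∀ (n : ℕ) (a b : ↥S), ((LS.coeff n a b : ↥S) : R) = L.coeff n (a : R) (b : R))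
    (LT : LieConformalAlgebra ↥T)
    (hLTd : ∀ a : ↥T, (LT.d a : R) = L.d (a : R))
    (hLTc : ∀ (n : ℕ) (a b : ↥T), ((LT.coeff n a b : ↥T) : R) = L.coeff n (a : R) (b : R)) :
    -- every generalized conformal derivation preserves S and T
    (∀ D : CLin L, IsGDer D →
      (∀ a ∈ S, ∀ n : ℕ, D.coeff n a ∈ S) ∧ (∀ a ∈ T, ∀ n : ℕ, D.coeff n a ∈ T)) ∧
    -- restriction to S and T is injective
    (∀ D D' : CLin L,
      (∀ (lam : ℂ), ∀ a ∈ S, D.app lam a = D'.app lam a) →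
      (∀ (lam : ℂ), ∀ a ∈ T, D.app lam a = D'.app lam a) →
      ∀ (lam : ℂ) (a : R), D.app lam a = D'.app lam a) ∧
    -- GDer(R) = GDer(S) ⊕ GDer(T)
    ((∀ (D : CLin L) (DS : CLin LS) (DT : CLin LT),
        IsRestriction L S LS D DS → IsRestriction L T LT D DT →
        (IsGDer D ↔ IsGDer DS ∧ IsGDer DT)) ∧
      (∀ D : CLin L, IsGDer D → ∃ (DS : CLin LS) (DT : CLin LT),
        IsRestriction L S LS D DS ∧ IsRestriction L T LT D DT) ∧
      (∀ (DS : CLin LS) (DT : CLin LT), IsGDer DS → IsGDer DT →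
        ∃ D : CLin L, IsRestriction L S LS D DS ∧ IsRestriction L T LT D DT)) ∧
    -- QDer(R) = QDer(S) ⊕ QDer(T)
    ((∀ (D : CLin L) (DS : CLin LS) (DT : CLin LT),
        IsRestriction L S LS D DS → IsRestriction L T LT D DT →
        (IsQDer D ↔ IsQDer DS ∧ IsQDer DT)) ∧
      (∀ D : CLin L, IsQDer D → ∃ (DS : CLin LS) (DT : CLin LT),
        IsRestriction L S LS D DS ∧ IsRestriction L T LT D DT) ∧
      (∀ (DS : CLin LS) (DT : CLin LT), IsQDer DS → IsQDer DT →
        ∃ D : CLin L, IsRestriction L S LS D DS ∧ IsRestriction L T LT D DT)) ∧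
    -- C(R) = C(S) ⊕ C(T)
    ((∀ (D : CLin L) (DS : CLin LS) (DT : CLin LT),
        IsRestriction L S LS D DS → IsRestriction L T LT D DT →
        (IsCent D ↔ IsCent DS ∧ IsCent DT)) ∧
      (∀ D : CLin L, IsCent D → ∃ (DS : CLin LS) (DT : CLin LT),
        IsRestriction L S LS D DS ∧ IsRestriction L T LT D DT) ∧
      (∀ (DS : CLin LS) (DT : CLin LT), IsCent DS → IsCent DT →
        ∃ D : CLin L, IsRestriction L S LS D DS ∧ IsRestriction L T LT D DT)) ∧
    -- QC(R) = QC(S) ⊕ QC(T)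
    ((∀ (D : CLin L) (DS : CLin LS) (DT : CLin LT),
        IsRestriction L S LS D DS → IsRestriction L T LT D DT →
        (IsQC D ↔ IsQC DS ∧ IsQC DT)) ∧
      (∀ D : CLin L, IsQC D → ∃ (DS : CLin LS) (DT : CLin LT),
        IsRestriction L S LS D DS ∧ IsRestriction L T LT D DT) ∧
      (∀ (DS : CLin LS) (DT : CLin LT), IsQC DS → IsQC DT →
        ∃ D : CLin L, IsRestriction L S LS D DS ∧ IsRestriction L T LT D DT)) := by
  have h : IsIdealDecomposition L S T LS LT :=
    ⟨hSd, hSb, hTd, hTb, hcompl, hLSd, hLSc, hLTd, hLTc⟩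
  have hres : ∀ D : CLin L, IsGDer D ∨ IsQC D → ∃ (DS : CLin LS) (DT : CLin LT),
      IsRestriction L S LS D DS ∧ IsRestriction L T LT D DT := by
    rintro D (hD | hD)
    · exact h.exists_restrictions (h.app_mem_of_isGDer hZ hD) (h.symm.app_mem_of_isGDer hZ hD)
    · exact h.exists_restrictions (h.app_mem_of_isQC hZ hD) (h.symm.app_mem_of_isQC hZ hD)
  refine ⟨fun D hD => ⟨fun a ha => ?_, fun a ha => ?_⟩, fun D D' hS hT z a => ?_,
    ⟨fun D DS DT hS hT => ⟨fun hD => ?_, fun hD => ?_⟩, fun D hD => hres D (.inl hD),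
      fun DS DT _ _ => h.exists_of_restrictions DS DT⟩,
    ⟨fun D DS DT hS hT => ⟨fun hD => ?_, fun hD => ?_⟩, fun D hD => hres D (.inl hD.isGDer),
      fun DS DT _ _ => h.exists_of_restrictions DS DT⟩,
    ⟨fun D DS DT hS hT => ⟨fun hD => ?_, fun hD => ?_⟩, fun D hD => hres D (.inr hD.isQC),
      fun DS DT _ _ => h.exists_of_restrictions DS DT⟩,
    ⟨fun D DS DT hS hT => ⟨fun hD => ?_, fun hD => ?_⟩, fun D hD => hres D (.inr hD),
      fun DS DT _ _ => h.exists_of_restrictions DS DT⟩⟩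
  · exact D.coeff_mem_of_app_mem S fun z => h.app_mem_of_isGDer hZ hD z a ha
  · exact D.coeff_mem_of_app_mem T fun z => h.symm.app_mem_of_isGDer hZ hD z a ha
  · rw [← h.proj_add_proj a, D.app_add, D'.app_add, hS z _ (h.proj a).2,
      hT z _ (h.symm.proj a).2]
  · exact ⟨h.isGDer_restriction hS hD, h.symm.isGDer_restriction hT hD⟩
  · exact h.isGDer_of_restrictions hS hT hD.1 hD.2
  · exact ⟨h.isQDer_restriction hS hD, h.symm.isQDer_restriction hT hD⟩
  · exact h.isQDer_of_restrictions hS hT hD.1 hD.2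
  · exact ⟨h.isCent_restriction hS hD, h.symm.isCent_restriction hT hD⟩
  · exact h.isCent_of_restrictions hS hT hD.1 hD.2
  · exact ⟨h.isQC_restriction hS hD, h.symm.isQC_restriction hT hD⟩
  · exact h.isQC_of_restrictions hS hT hD.1 hD.2
end

section
/- Let R be a Lie conformal algebra admitting a decomposition of ℂ[∂]-modules R = [R,R] ⊕ U, and let R̃ and f : QDer(R) → gc(R̃) be as defined. Then: (1) f is injective; (2) f(D) does not depend on the choice of the associated element D′ (if D′ and D″ both witness that D ∈ QDer(R), the two resulting maps coincide); (3) f(D) ∈ CDer(R̃) for every D ∈ QDer(R). -/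
open scoped BigOperators

universe u

section RTilde

variable {R : Type u} [AddCommGroup R] [Module ℂ R]

/-- The derived subalgebra `[R,R]`: the `ℂ`-span of all `λ`-coefficients of brackets. -/
def derSpan (L : LieConformalAlgebra R) : Submodule ℂ R :=
  Submodule.span ℂ {x : R | ∃ (n : ℕ) (a b : R), x = L.coeff n a b}

/-- `D'` witnesses that `D` is a conformal quasiderivation:
`[(D_λ a)_{λ+μ} b] + [a_μ (D_λ b)] = D'_λ([a_μ b])`. -/
def QDerWitness {L : LieConformalAlgebra R} (D D' : CLin L) : Prop :=
  ∀ (lam mu : ℂ) (a b : R),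
    L.brk (lam + mu) (D.app lam a) b + L.brk mu a (D.app lam b)
      = D'.app lam (L.brk mu a b)

/-- `Lt` is the Lie conformal algebra `R̃ = Rt ⊕ Rt²`, modelled on `R × R`
(first component: coefficient of `t`; second: coefficient of `t²`), with
`∂` acting componentwise and `[at _λ bt] = [a_λ b]t²`, all other products zero. -/
def IsRTilde (L : LieConformalAlgebra R) (Lt : LieConformalAlgebra (R × R)) : Prop :=
  (∀ x : R × R, Lt.d x = (L.d x.1, L.d x.2)) ∧
  (∀ (n : ℕ) (x y : R × R), Lt.coeff n x y = (0, L.coeff n x.1 y.1))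

/-- `fD` is the map `f(D) ∈ gc(R̃)` determined by
`f(D)_λ(at + bt² + ut²) = D_λ(a)t + D'_λ(b)t²` for `a ∈ R`, `b ∈ [R,R]`, `u ∈ U`. -/
def IsFMap (L : LieConformalAlgebra R) (U : Submodule ℂ R)
    {Lt : LieConformalAlgebra (R × R)} (D D' : CLin L) (fD : CLin Lt) : Prop :=
  ∀ (lam : ℂ) (a b u : R), b ∈ derSpan L → u ∈ U →
    fD.app lam (a, b + u) = (D.app lam a, D'.app lam b)

end RTilde

/-- A vector-valued polynomial vanishing at every point of an infinite field has zero
coefficients. -/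
theorem eq_zero_of_forall_sum_pow_smul_eq_zero {K V : Type*} [Field K] [Infinite K]
    [AddCommGroup V] [Module K V] {N : ℕ} {v : ℕ → V}
    (h : ∀ t : K, ∑ n ∈ Finset.range N, t ^ n • v n = 0) {n : ℕ} (hn : n < N) : v n = 0 := by
  refine (Module.forall_dual_apply_eq_zero_iff K (v n)).mp fun φ => ?_
  have hp : (∑ k ∈ Finset.range N, Polynomial.monomial k (φ (v k))) = 0 := by
    refine Polynomial.funext fun t => ?_
    have ht := congrArg φ (h t)
    simpa [Polynomial.eval_finsetSum, mul_comm] using ht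
  have hc := congrArg (fun p => Polynomial.coeff p n) hp
  simpa [Polynomial.finsetSum_coeff, Polynomial.coeff_monomial, hn] using hc

theorem finsum_pow_smul_eq_sum_range {V : Type*} [AddCommGroup V] [Module ℂ V] {v : ℕ → V}
    {N : ℕ} (hN : ∀ n, N ≤ n → v n = 0) (t : ℂ) :
    ∑ᶠ n : ℕ, t ^ n • v n = ∑ n ∈ Finset.range N, t ^ n • v n := by
  refine finsum_eq_sum_of_support_subset _ fun n hn => ?_
  by_contra hlt
  exact hn (by simp [hN n (by simpa using hlt)])

section

variable {R : Type u} [AddCommGroup R] [Module ℂ R]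

namespace CLin

variable {L : LieConformalAlgebra R}

theorem support_finite (D : CLin L) (lam : ℂ) (a : R) :
    (Function.support fun n => lam ^ n • D.coeff n a).Finite := by
  obtain ⟨N, hN⟩ := D.locality a
  refine (Finset.range N).finite_toSet.subset fun n hn => ?_
  by_contra hlt
  exact hn (by simp [hN n (by simpa using hlt)])

/-- The map `a ↦ D_λ(a)` at a point `λ`, as a `ℂ`-linear map. -/
noncomputable def appLin (D : CLin L) (lam : ℂ) : R →ₗ[ℂ] R where
  toFun := D.app lam
  map_add' a b := by
    simp only [app, map_add, smul_add]
    exact finsum_add_distrib (D.support_finite lam a) (D.support_finite lam b)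
  map_smul' c a := by
    simp only [app, map_smul, RingHom.id_apply, smul_comm _ c]
    exact (smul_finsum' c (D.support_finite lam a)).symm

@[simp]
theorem appLin_apply (D : CLin L) (lam : ℂ) (a : R) : D.appLin lam a = D.app lam a := rfl

end CLin

theorem brk_mem_derSpan (L : LieConformalAlgebra R) (mu : ℂ) (a b : R) :
    L.brk mu a b ∈ derSpan L := by
  obtain ⟨N, hN⟩ := L.locality a b
  rw [LieConformalData.brk, finsum_pow_smul_eq_sum_range hN]
  exact Submodule.sum_mem _ fun n _ =>
    Submodule.smul_mem _ _ (Submodule.subset_span ⟨n, a, b, rfl⟩)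

/-- A linear map vanishing on all values of the `λ`-bracket vanishes on `[R,R]`. -/
theorem derSpan_le_ker {V : Type*} [AddCommGroup V] [Module ℂ V] {L : LieConformalAlgebra R}
    {T : R →ₗ[ℂ] V} (hT : ∀ (mu : ℂ) (a b : R), T (L.brk mu a b) = 0) :
    derSpan L ≤ LinearMap.ker T := by
  refine Submodule.span_le.mpr ?_
  rintro _ ⟨n, a, b, rfl⟩
  obtain ⟨N, hN⟩ := L.locality a b
  rcases lt_or_ge n N with hn | hn
  · refine eq_zero_of_forall_sum_pow_smul_eq_zero (K := ℂ) (N := N)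
      (v := fun k => T (L.coeff k a b)) (fun t => ?_) hn
    have ht := hT t a b
    rw [LieConformalData.brk, finsum_pow_smul_eq_sum_range hN] at ht
    simpa using ht
  · simp [hN n hn]

/-- Two witnesses of the same conformal quasiderivation agree on `[R,R]`. -/
theorem QDerWitness.app_eq_of_mem_derSpan {L : LieConformalAlgebra R} {D D' D'' : CLin L}
    (h' : QDerWitness D D') (h'' : QDerWitness D D'') (lam : ℂ) {b : R} (hb : b ∈ derSpan L) :
    D'.app lam b = D''.app lam b := by
  have hker := derSpan_le_ker (L := L) (T := D'.appLin lam - D''.appLin lam)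
    (fun mu a c => by simp [← h' lam mu a c, ← h'' lam mu a c]) hb
  simpa [sub_eq_zero] using hker

theorem IsRTilde.brk_eq {L : LieConformalAlgebra R} {Lt : LieConformalAlgebra (R × R)}
    (hLt : IsRTilde L Lt) (mu : ℂ) (x y : R × R) :
    Lt.brk mu x y = (0, L.brk mu x.1 y.1) := by
  obtain ⟨N, hN⟩ := L.locality x.1 y.1
  have hN' : ∀ n, N ≤ n → Lt.coeff n x y = 0 := fun n hn => by simp [hLt.2, hN n hn]
  rw [LieConformalData.brk, LieConformalData.brk, finsum_pow_smul_eq_sum_range hN',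
    finsum_pow_smul_eq_sum_range hN]
  ext <;> simp [hLt.2, Prod.fst_sum, Prod.snd_sum]

end

/-- Let `R = [R,R] ⊕ U` as `ℂ[∂]`-modules, let `R̃ = Rt ⊕ Rt²` and
let `f : QDer(R) → gc(R̃)` be as defined.  Then (1) `f` is injective; (2) `f(D)` does
not depend on the choice of the witness `D'`; (3) `f(D) ∈ CDer(R̃)` for `D ∈ QDer(R)`. -/
theorem stmt16 {R : Type u} [AddCommGroup R] [Module ℂ R] (L : LieConformalAlgebra R)
    (U : Submodule ℂ R) (hUd : ∀ u ∈ U, L.d u ∈ U) (hcompl : IsCompl (derSpan L) U)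
    (Lt : LieConformalAlgebra (R × R)) (hLt : IsRTilde L Lt) :
    -- (1) f is injective
    (∀ (D₁ D₂ D₁' D₂' : CLin L) (fD₁ fD₂ : CLin Lt),
      QDerWitness D₁ D₁' → QDerWitness D₂ D₂' →
      IsFMap L U D₁ D₁' fD₁ → IsFMap L U D₂ D₂' fD₂ →
      (∀ (lam : ℂ) (x : R × R), fD₁.app lam x = fD₂.app lam x) →
      ∀ (lam : ℂ) (a : R), D₁.app lam a = D₂.app lam a) ∧
    -- (2) f(D) does not depend on the choice of D'
    (∀ (D D' D'' : CLin L) (fD' fD'' : CLin Lt),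
      QDerWitness D D' → QDerWitness D D'' →
      IsFMap L U D D' fD' → IsFMap L U D D'' fD'' →
      ∀ (lam : ℂ) (x : R × R), fD'.app lam x = fD''.app lam x) ∧
    -- (3) f(QDer(R)) ⊆ CDer(R̃)
    (∀ (D D' : CLin L) (fD : CLin Lt),
      QDerWitness D D' → IsFMap L U D D' fD → IsCDer fD) := by
  have decomp (y : R) : ∃ b ∈ derSpan L, ∃ u ∈ U, b + u = y :=
    Submodule.mem_sup.mp (hcompl.sup_eq_top ▸ Submodule.mem_top)
  refine ⟨?_, ?_, ?_⟩
  · intro D₁ D₂ D₁' D₂' fD₁ fD₂ _ _ hf₁ hf₂ hf lam a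
    have h := hf lam (a, 0 + 0)
    rw [hf₁ lam a 0 0 (zero_mem _) (zero_mem _), hf₂ lam a 0 0 (zero_mem _) (zero_mem _)] at h
    exact congrArg Prod.fst h
  · rintro D D' D'' fD' fD'' h' h'' hf' hf'' lam ⟨a, y⟩
    obtain ⟨b, hb, u, hu, rfl⟩ := decomp y
    rw [hf' lam a b u hb hu, hf'' lam a b u hb hu, h'.app_eq_of_mem_derSpan h'' lam hb]
  · intro D D' fD h hf lam mu x y
    have fst_app (z : R × R) : (fD.app lam z).1 = D.app lam z.1 := by
      obtain ⟨a, w⟩ := z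
      obtain ⟨b, hb, u, hu, rfl⟩ := decomp w
      rw [hf lam a b u hb hu]
    have hbrk := hf lam 0 (L.brk mu x.1 y.1) 0 (brk_mem_derSpan L mu x.1 y.1) (zero_mem U)
    rw [add_zero, ← h lam mu, ← D.appLin_apply, map_zero] at hbrk
    rw [hLt.brk_eq, hLt.brk_eq, hLt.brk_eq, fst_app, fst_app, hbrk]
    simp
end
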